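/- For t ∈ ℂ with t³ - 3t² + 2t - 2 = 0, set t_1 = t - 1, t_2 = t, t_3 = (t-1)/(t-2), and let A(t) be the arrangement of the 12 projective lines {X=0}, {Y=0}, {Z=0}, {X-Z=0}, {Y-Z=0}, {X-t_1 Z=0}, {X-t_2 Z=0}, {X-t_3 Z=0}, {X+(1-t_2)Y-Z=0}, {X+(t_2-t_3)Y-t_2 Z=0}, {X-t_1 Y=0}, {X+t_3 Y-t_3 Z=0}. The cubic t³ - 3t² + 2t - 2 has three distinct complex roots, and for any two distinct roots t ≠ t' the arrangements A(t) and A(t') are lattice isomorphic but not projectively equivalent. -/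

import Mathlib

open Submodule Module

/-- The underlying vector space `ℂ³` for the linear model of `ℂP²`. -/
abbrev Vc : Type := Fin 3 → ℂ

/-- A projective point of `ℂP²`: a 1-dimensional `ℂ`-subspace of `ℂ³`. -/
def IsProjPoint (p : Submodule ℂ Vc) : Prop := Module.finrank ℂ p = 1

/-- A projective line of `ℂP²`: a 2-dimensional `ℂ`-subspace of `ℂ³`. -/
def IsProjLine (L : Submodule ℂ Vc) : Prop := Module.finrank ℂ L = 2

/-- A line arrangement: a finite set of (pairwise distinct) projective lines. -/
def LineArrangement (A : Finset (Submodule ℂ Vc)) : Prop := ∀ L ∈ A, IsProjLine L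

/-- The multiplicity of a projective point `p` with respect to `A`:
the number of lines of `A` containing `p`. -/
noncomputable def mult (A : Finset (Submodule ℂ Vc)) (p : Submodule ℂ Vc) : ℕ :=
  Set.ncard {L : Submodule ℂ Vc | L ∈ A ∧ p ≤ L}

/-- `nPts A r` is the number of projective points of multiplicity exactly `r` w.r.t. `A`. -/
noncomputable def nPts (A : Finset (Submodule ℂ Vc)) (r : ℕ) : ℕ :=
  Set.ncard {p : Submodule ℂ Vc | IsProjPoint p ∧ mult A p = r}

/-- A multiple point of `A`: a projective point of multiplicity at least 3. -/
def IsMultPoint (A : Finset (Submodule ℂ Vc)) (p : Submodule ℂ Vc) : Prop :=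
  IsProjPoint p ∧ 3 ≤ mult A p

/-- `A` is nonreductive if every line of `A` contains at least 3 multiple points of `A`. -/
def Nonreductive (A : Finset (Submodule ℂ Vc)) : Prop :=
  ∀ L ∈ A, 3 ≤ Set.ncard {p : Submodule ℂ Vc | IsMultPoint A p ∧ p ≤ L}

/-- The projective line `{aX + bY + cZ = 0}`. -/
noncomputable def lineEq (a b c : ℂ) : Submodule ℂ Vc :=
  LinearMap.ker (a • (LinearMap.proj 0 : Vc →ₗ[ℂ] ℂ) + b • (LinearMap.proj 1 : Vc →ₗ[ℂ] ℂ)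
    + c • (LinearMap.proj 2 : Vc →ₗ[ℂ] ℂ))

/-- Lattice isomorphism of two arrangements of `n` lines. -/
def LatticeIso (n : ℕ) (A B : Finset (Submodule ℂ Vc)) : Prop :=
  ∃ L H : Fin n → Submodule ℂ Vc,
    Function.Injective L ∧ Function.Injective H ∧
    (∀ M, M ∈ A ↔ ∃ i, L i = M) ∧ (∀ M, M ∈ B ↔ ∃ i, H i = M) ∧
    ∀ S : Finset (Fin n), S.Nonempty →
      Module.finrank ℂ ↥(⨅ i ∈ S, L i) = Module.finrank ℂ ↥(⨅ i ∈ S, H i)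

/-- Projective equivalence of two arrangements. -/
def ProjEquiv (A B : Finset (Submodule ℂ Vc)) : Prop :=
  ∃ g : Vc ≃ₗ[ℂ] Vc,
    (fun M => Submodule.map (g : Vc →ₗ[ℂ] Vc) M) '' (A : Set (Submodule ℂ Vc))
      = (B : Set (Submodule ℂ Vc))

/-- The element `a + b s + c s²` of `ℤ[s]`, where `s³ = s + 2`, as the triple `(a, b, c)`. -/
abbrev CubicInt : Type := ℤ × ℤ × ℤ

namespace CubicInt

/-- Multiplication in `ℤ[s]`, reduced with `s³ = s + 2`. -/
def mul (x y : CubicInt) : CubicInt :=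
  (x.1 * y.1 + 2 * (x.2.1 * y.2.2 + x.2.2 * y.2.1),
    x.1 * y.2.1 + x.2.1 * y.1 + (x.2.1 * y.2.2 + x.2.2 * y.2.1) + 2 * (x.2.2 * y.2.2),
    x.1 * y.2.2 + x.2.1 * y.2.1 + x.2.2 * y.1 + x.2.2 * y.2.2)

/-- The product of the nontrivial conjugates. -/
def cofactor (x : CubicInt) : CubicInt :=
  ((x.1 + x.2.2) ^ 2 - x.2.1 * (x.2.1 + 2 * x.2.2),
    x.2.2 * (x.2.1 + 2 * x.2.2) - x.2.1 * (x.1 + x.2.2),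
    x.2.1 ^ 2 - x.2.2 * (x.1 + x.2.2))

/-- The norm of `ℤ[s]` over `ℤ`. -/
def norm (x : CubicInt) : ℤ :=
  x.1 * (cofactor x).1 + 2 * x.2.2 * (cofactor x).2.1 + 2 * x.2.1 * (cofactor x).2.2

/-- The determinant of the matrix with rows `u`, `v`, `w`. -/
def det (u v w : Fin 3 → CubicInt) : CubicInt :=
  mul (u 0) (mul (v 1) (w 2) - mul (v 2) (w 1)) - mul (u 1) (mul (v 0) (w 2) - mul (v 2) (w 0))
    + mul (u 2) (mul (v 0) (w 1) - mul (v 1) (w 0))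

/-- Evaluation at a complex number. -/
noncomputable def eval (s : ℂ) (x : CubicInt) : ℂ := x.1 + x.2.1 * s + x.2.2 * s ^ 2

variable {s : ℂ}

lemma eval_zero : eval s 0 = 0 := by simp [eval]

lemma eval_add (x y : CubicInt) : eval s (x + y) = eval s x + eval s y := by
  simp only [eval, Prod.fst_add, Prod.snd_add]; push_cast; ring

lemma eval_sub (x y : CubicInt) : eval s (x - y) = eval s x - eval s y := by
  simp only [eval, Prod.fst_sub, Prod.snd_sub]; push_cast; ring

lemma eval_mul (hs : s ^ 3 = s + 2) (x y : CubicInt) :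
    eval s (mul x y) = eval s x * eval s y := by
  simp only [eval, mul]; push_cast
  linear_combination (-(x.2.1 * y.2.2 + x.2.2 * y.2.1 : ℂ) - x.2.2 * y.2.2 * s) * hs

lemma eval_mul_eval_cofactor (hs : s ^ 3 = s + 2) (x : CubicInt) :
    eval s x * eval s (cofactor x) = norm x := by
  rw [← eval_mul hs]
  simp only [eval, mul, norm, cofactor]; push_cast; ring

lemma eval_ne_zero (hs : s ^ 3 = s + 2) {x : CubicInt} (hx : norm x ≠ 0) : eval s x ≠ 0 := by
  intro h
  have := eval_mul_eval_cofactor hs x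
  rw [h, zero_mul] at this
  exact hx (by exact_mod_cast this.symm)

lemma eval_det (hs : s ^ 3 = s + 2) (u v w : Fin 3 → CubicInt) :
    eval s (det u v w) = Matrix.det !![eval s (u 0), eval s (u 1), eval s (u 2);
      eval s (v 0), eval s (v 1), eval s (v 2); eval s (w 0), eval s (w 1), eval s (w 2)] := by
  simp only [det, eval_add, eval_sub, eval_mul hs, Matrix.det_fin_three, Matrix.of_apply,
    Matrix.cons_val', Matrix.cons_val_zero, Matrix.cons_val_one, Matrix.cons_val,
    Matrix.cons_val_fin_one]
  ring

end CubicInt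

lemma mem_lineEq {a b c : ℂ} {x : Vc} :
    x ∈ lineEq a b c ↔ a * x 0 + b * x 1 + c * x 2 = 0 := by
  simp [lineEq]

lemma lineEq_smul {k : ℂ} (hk : k ≠ 0) (a b c : ℂ) :
    lineEq (k * a) (k * b) (k * c) = lineEq a b c := by
  ext x
  rw [mem_lineEq, mem_lineEq, ← mul_eq_zero_iff_left hk (b := a * x 0 + b * x 1 + c * x 2)]
  ring_nf

lemma finrank_lineEq {a b c : ℂ} (h : a ≠ 0 ∨ b ≠ 0 ∨ c ≠ 0) :
    finrank ℂ (lineEq a b c) = 2 := by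
  have hne : (a • (LinearMap.proj 0 : Vc →ₗ[ℂ] ℂ) + b • (LinearMap.proj 1 : Vc →ₗ[ℂ] ℂ)
      + c • (LinearMap.proj 2 : Vc →ₗ[ℂ] ℂ)) ≠ 0 := by
    intro h0
    have h1 := LinearMap.congr_fun h0 (Pi.single 0 1)
    have h2 := LinearMap.congr_fun h0 (Pi.single 1 1)
    have h3 := LinearMap.congr_fun h0 (Pi.single 2 1)
    simp at h1 h2 h3
    tauto
  have h1 : finrank ℂ (lineEq a b c) + 1 = finrank ℂ Vc :=
    Module.Dual.finrank_ker_add_one_of_ne_zero hne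
  rw [Module.finrank_fin_fun] at h1
  omega

lemma lineEq_inf_ne_bot_iff (a b c a' b' c' a'' b'' c'' : ℂ) :
    lineEq a b c ⊓ lineEq a' b' c' ⊓ lineEq a'' b'' c'' ≠ ⊥ ↔
      Matrix.det !![a, b, c; a', b', c'; a'', b'', c''] = 0 := by
  rw [← Matrix.exists_mulVec_eq_zero_iff, Submodule.ne_bot_iff]
  refine exists_congr fun x => ?_
  rw [and_comm, Submodule.mem_inf, Submodule.mem_inf, mem_lineEq, mem_lineEq, mem_lineEq,
    funext_iff, Fin.forall_fin_succ, Fin.forall_fin_two]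
  simp [Matrix.mulVec, dotProduct, Fin.sum_univ_three, and_assoc]

lemma inf_ne_bot_of_finrank_eq_two {L M : Submodule ℂ Vc} (hL : finrank ℂ L = 2)
    (hM : finrank ℂ M = 2) : L ⊓ M ≠ ⊥ := by
  intro h
  have h1 := Submodule.finrank_sup_add_finrank_inf_eq L M
  have h2 := Submodule.finrank_le (L ⊔ M)
  rw [h, finrank_bot] at h1
  simp only [Module.finrank_fin_fun] at h2
  omega

lemma finrank_inf_of_ne {L M : Submodule ℂ Vc} (hL : finrank ℂ L = 2)
    (hM : finrank ℂ M = 2) (h : L ≠ M) : finrank ℂ ↥(L ⊓ M) = 1 := by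
  have h0 : finrank ℂ ↥(L ⊓ M) ≠ 0 := fun h0 =>
    inf_ne_bot_of_finrank_eq_two hL hM (Submodule.finrank_eq_zero.1 h0)
  have h2 : finrank ℂ ↥(L ⊓ M) < 2 := by
    by_contra! h2
    have e1 := Submodule.eq_of_le_of_finrank_le (inf_le_left : L ⊓ M ≤ L) (by omega)
    have e2 := Submodule.eq_of_le_of_finrank_le (inf_le_right : L ⊓ M ≤ M) (by omega)
    exact h (e1.symm.trans e2)
  omega

lemma le_of_inf_ne_bot {P N : Submodule ℂ Vc} (hP : finrank ℂ P = 1) (h : P ⊓ N ≠ ⊥) :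
    P ≤ N := by
  have h0 : finrank ℂ ↥(P ⊓ N) ≠ 0 := fun h0 => h (Submodule.finrank_eq_zero.1 h0)
  have := Submodule.eq_of_le_of_finrank_le (inf_le_left : P ⊓ N ≤ P) (by omega)
  exact inf_eq_left.1 this

/-- The dimensions of all intersections of a family of distinct lines are determined by
which triples of lines are concurrent. -/
lemma finrank_iInf_eq_of_concurrent_iff {ι : Type*} {L H : ι → Submodule ℂ Vc}
    (hL : ∀ i, finrank ℂ (L i) = 2) (hH : ∀ i, finrank ℂ (H i) = 2)
    (hLi : Function.Injective L) (hHi : Function.Injective H)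
    (h : ∀ i j k, L i ⊓ L j ⊓ L k ≠ ⊥ ↔ H i ⊓ H j ⊓ H k ≠ ⊥)
    (S : Finset ι) (hS : S.Nonempty) :
    finrank ℂ ↥(⨅ i ∈ S, L i) = finrank ℂ ↥(⨅ i ∈ S, H i) := by
  have key : ∀ F : ι → Submodule ℂ Vc, (∀ i, finrank ℂ (F i) = 2) → Function.Injective F →
      ∀ i ∈ S, ∀ j ∈ S, i ≠ j →
      ((∀ k ∈ S, F i ⊓ F j ⊓ F k ≠ ⊥) → finrank ℂ ↥(⨅ i ∈ S, F i) = 1) ∧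
      ((∃ k ∈ S, F i ⊓ F j ⊓ F k = ⊥) → finrank ℂ ↥(⨅ i ∈ S, F i) = 0) := by
    intro F hF hFi i hi j hj hij
    have h1 := finrank_inf_of_ne (hF i) (hF j) (hFi.ne hij)
    constructor
    · intro hk
      have : ⨅ i ∈ S, F i = F i ⊓ F j :=
        le_antisymm (le_inf (iInf₂_le i hi) (iInf₂_le j hj))
          (le_iInf₂ fun k hkS => le_of_inf_ne_bot h1 (hk k hkS))
      rw [this, h1]
    · rintro ⟨k, hk, hbot⟩
      have : ⨅ i ∈ S, F i = ⊥ := eq_bot_iff.2 <| hbot ▸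
        le_inf (le_inf (iInf₂_le i hi) (iInf₂_le j hj)) (iInf₂_le k hk)
      rw [this, finrank_bot]
  obtain ⟨i, rfl⟩ | hnt := hS.exists_eq_singleton_or_nontrivial
  · rw [Finset.iInf_singleton, Finset.iInf_singleton, hL, hH]
  obtain ⟨i, hi, j, hj, hij⟩ := hnt
  have kL := key L hL hLi i hi j hj hij
  have kH := key H hH hHi i hi j hj hij
  by_cases hk : ∀ k ∈ S, L i ⊓ L j ⊓ L k ≠ ⊥
  · rw [kL.1 hk, kH.1 fun k hkS => (h i j k).1 (hk k hkS)]
  · push Not at hk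
    obtain ⟨k, hkS, hbot⟩ := hk
    rw [kL.2 ⟨k, hkS, hbot⟩, kH.2 ⟨k, hkS, by_contra fun hne => (h i j k).2 hne hbot⟩]

/-- Integral multiples of the coefficients of the twelve lines, where `s = t - 1`, so that
`2 (t - 1) / (t - 2) = s² + s + 2`. -/
def coeffs : Fin 12 → Fin 3 → CubicInt :=
  ![![(1, 0, 0), 0, 0], ![0, (1, 0, 0), 0], ![0, 0, (1, 0, 0)],
    ![(1, 0, 0), 0, (-1, 0, 0)], ![0, (1, 0, 0), (-1, 0, 0)],
    ![(1, 0, 0), 0, (0, -1, 0)], ![(1, 0, 0), 0, (-1, -1, 0)], ![(2, 0, 0), 0, (-2, -1, -1)],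
    ![(1, 0, 0), (0, -1, 0), (-1, 0, 0)], ![(2, 0, 0), (0, 1, -1), (-2, -2, 0)],
    ![(1, 0, 0), (0, -1, 0), 0], ![(2, 0, 0), (2, 1, 1), (-2, -1, -1)]]

/-- The twelve lines of the arrangement with parameter `t = s + 1`. -/
noncomputable def arrLine (s : ℂ) (i : Fin 12) : Submodule ℂ Vc :=
  lineEq (CubicInt.eval s (coeffs i 0)) (CubicInt.eval s (coeffs i 1))
    (CubicInt.eval s (coeffs i 2))

/-- The concurrent triples of lines. -/
abbrev Concurrent (i j k : Fin 12) : Prop :=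
  CubicInt.det (coeffs i) (coeffs j) (coeffs k) = 0

lemma norm_det_ne_zero : ∀ i j k : Fin 12, ¬ Concurrent i j k →
    CubicInt.norm (CubicInt.det (coeffs i) (coeffs j) (coeffs k)) ≠ 0 := by
  decide +kernel

lemma exists_not_concurrent : ∀ i j : Fin 12, i ≠ j → ∃ k, ¬ Concurrent i j k := by
  decide +kernel

lemma exists_norm_coeffs_ne_zero : ∀ i : Fin 12, ∃ j, CubicInt.norm (coeffs i j) ≠ 0 := by
  decide +kernel

/-- The number of ordered pairs of lines concurrent with the line `i`. -/
def concurrencyDegree (i : Fin 12) : ℕ :=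
  (Finset.univ.filter fun p : Fin 12 × Fin 12 => Concurrent i p.1 p.2).card

lemma arrLine_inf_ne_bot_iff {s : ℂ} (hs : s ^ 3 = s + 2) (i j k : Fin 12) :
    arrLine s i ⊓ arrLine s j ⊓ arrLine s k ≠ ⊥ ↔ Concurrent i j k := by
  unfold arrLine
  rw [lineEq_inf_ne_bot_iff, ← CubicInt.eval_det hs]
  constructor
  · intro h
    by_contra hc
    exact CubicInt.eval_ne_zero hs (norm_det_ne_zero i j k hc) h
  · intro h
    rw [h, CubicInt.eval_zero]

lemma finrank_arrLine {s : ℂ} (hs : s ^ 3 = s + 2) (i : Fin 12) :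
    finrank ℂ (arrLine s i) = 2 := by
  apply finrank_lineEq
  obtain ⟨j, hj⟩ := exists_norm_coeffs_ne_zero i
  have := CubicInt.eval_ne_zero hs hj
  fin_cases j <;> simp_all

lemma arrLine_injective {s : ℂ} (hs : s ^ 3 = s + 2) : Function.Injective (arrLine s) := by
  intro i j hij
  by_contra hne
  obtain ⟨k, hk⟩ := exists_not_concurrent i j hne
  rw [← arrLine_inf_ne_bot_iff hs, hij, inf_idem, not_not] at hk
  exact inf_ne_bot_of_finrank_eq_two (finrank_arrLine hs j) (finrank_arrLine hs k) hk

/-- A permutation of the twelve lines that preserves concurrency fixes the lines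
`X = 0`, `Z = 0`, `X = Z` and `X = s Z`. -/
lemma fixes_of_concurrent_iff (σ : Equiv.Perm (Fin 12))
    (hσ : ∀ i j k, Concurrent (σ i) (σ j) (σ k) ↔ Concurrent i j k) :
    σ 0 = 0 ∧ σ 2 = 2 ∧ σ 3 = 3 ∧ σ 5 = 5 := by
  have hdeg : ∀ i, concurrencyDegree (σ i) = concurrencyDegree i := by
    intro i
    refine (Finset.card_equiv (σ.prodCongr σ) fun p => ?_).symm
    simp [hσ]
  have step : ∀ {i j k : Fin 12}, σ i = i → σ j = j → Concurrent i j k → i ≠ k → j ≠ k →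
      (∀ x, Concurrent i j x → i ≠ x → j ≠ x → x = k) → σ k = k := by
    intro i j k hi hj hc hik hjk hx
    refine hx _ ?_ ?_ ?_
    · simpa [hi, hj] using (hσ i j k).2 hc
    · simpa [hi] using σ.injective.ne hik
    · simpa [hj] using σ.injective.ne hjk
  have h5 : σ 5 = 5 :=
    (by decide +kernel : ∀ x, concurrencyDegree x = concurrencyDegree 5 → x = 5) _ (hdeg 5)
  have h10 : σ 10 = 10 :=
    (by decide +kernel : ∀ x, concurrencyDegree x = concurrencyDegree 10 → x = 10) _ (hdeg 10)
  have h4 : σ 4 = 4 := step h5 h10 (by decide +kernel) (by decide) (by decide) (by decide +kernel)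
  have h1 : σ 1 = 1 :=
    (by decide +kernel : ∀ x, concurrencyDegree x = concurrencyDegree 1 → x ≠ 4 → x = 1) _
      (hdeg 1) (fun h => absurd (σ.injective (h.trans h4.symm)) (by decide))
  have h0 : σ 0 = 0 := step h1 h10 (by decide +kernel) (by decide) (by decide) (by decide +kernel)
  have h2 : σ 2 = 2 := step h1 h4 (by decide +kernel) (by decide) (by decide) (by decide +kernel)
  have h11 : σ 11 = 11 :=
    step h0 h4 (by decide +kernel) (by decide) (by decide) (by decide +kernel)
  have h3 : σ 3 = 3 :=
    step h10 h11 (by decide +kernel) (by decide) (by decide) (by decide +kernel)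
  exact ⟨h0, h2, h3, h5⟩

/-- The cross-ratio of the lines `X = 0`, `Z = 0`, `X = Z`, `X = s Z` is a projective invariant. -/
lemma eq_of_map_pencil {s s' : ℂ} (g : Vc ≃ₗ[ℂ] Vc)
    (h0 : (lineEq 1 0 0).map (g : Vc →ₗ[ℂ] Vc) = lineEq 1 0 0)
    (h2 : (lineEq 0 0 1).map (g : Vc →ₗ[ℂ] Vc) = lineEq 0 0 1)
    (h3 : (lineEq 1 0 (-1)).map (g : Vc →ₗ[ℂ] Vc) = lineEq 1 0 (-1))
    (h5 : (lineEq 1 0 (-s)).map (g : Vc →ₗ[ℂ] Vc) = lineEq 1 0 (-s')) : s = s' := by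
  have key : ∀ {a b c a' b' c' : ℂ}, (lineEq a b c).map (g : Vc →ₗ[ℂ] Vc) = lineEq a' b' c' →
      ∀ x : Vc, a * x 0 + b * x 1 + c * x 2 = 0 ↔
        a' * g x 0 + b' * g x 1 + c' * g x 2 = 0 := by
    intro a b c a' b' c' h x
    rw [← mem_lineEq, ← mem_lineEq, ← h]
    simp
  have hg : ∀ x z : ℂ, g ![x, 0, z] = x • g ![1, 0, 0] + z • g ![0, 0, 1] := by
    intro x z
    rw [← map_smul, ← map_smul, ← map_add]
    congr 1
    ext i; fin_cases i <;> simp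
  have hw0 : g ![0, 0, 1] 0 = 0 := by simpa using (key h0 ![0, 0, 1]).1 (by simp)
  have hu2 : g ![1, 0, 0] 2 = 0 := by simpa using (key h2 ![1, 0, 0]).1 (by simp)
  have hu0 : g ![1, 0, 0] 0 ≠ 0 := fun h => by
    simpa using (key h0 ![1, 0, 0]).2 (by simpa using h)
  have e3 := (key h3 ![1, 0, 1]).1 (by simp)
  have e5 := (key h5 ![s, 0, 1]).1 (by simp)
  rw [hg] at e3 e5
  simp only [Pi.add_apply, Pi.smul_apply, smul_eq_mul, hw0, hu2] at e3 e5
  apply mul_right_cancel₀ hu0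
  linear_combination e5 - s' * e3

lemma exists_three_roots : ∃ a b c : ℂ, a ≠ b ∧ a ≠ c ∧ b ≠ c ∧
    a ^ 3 - 3 * a ^ 2 + 2 * a - 2 = 0 ∧ b ^ 3 - 3 * b ^ 2 + 2 * b - 2 = 0 ∧
    c ^ 3 - 3 * c ^ 2 + 2 * c - 2 = 0 := by
  obtain ⟨a, ha⟩ : ∃ a : ℂ, a ^ 3 - a - 2 = 0 := by
    obtain ⟨a, ha⟩ := IsAlgClosed.exists_root
      (Polynomial.X ^ 3 - Polynomial.X - 2 : Polynomial ℂ) (by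
        have : (Polynomial.X ^ 3 - Polynomial.X - 2 : Polynomial ℂ).degree = 3 := by
          compute_degree!
        rw [this]; decide)
    exact ⟨a, by simpa using ha⟩
  obtain ⟨d, hd⟩ := IsAlgClosed.exists_pow_nat_eq (4 - 3 * a ^ 2) (n := 2) (by norm_num)
  have hd0 : d ≠ 0 := by
    rintro rfl
    have h6 : a = 6 := by linear_combination 3 * ha - a * hd
    norm_num [h6] at ha
  have h3 : 3 * a ^ 2 - 1 ≠ 0 := by
    intro h
    have h6 : a = -3 := by linear_combination (-3 / 2) * ha + a / 2 * h
    norm_num [h6] at ha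
  refine ⟨a + 1, (-a + d) / 2 + 1, (-a - d) / 2 + 1, ?_, ?_, ?_, ?_, ?_, ?_⟩
  · intro h
    apply h3
    have e : d = 3 * a := by linear_combination -2 * h
    rw [e] at hd
    linear_combination hd / 4
  · intro h
    apply h3
    have e : d = -3 * a := by linear_combination 2 * h
    rw [e] at hd
    linear_combination hd / 4
  · intro h
    exact hd0 (by linear_combination h)
  · linear_combination ha
  · linear_combination ha + (d - 3 * a) / 8 * hd
  · linear_combination ha + (-d - 3 * a) / 8 * hd

open Classical in
/-- The cubic `t³-3t²+2t-2` has three distinct roots, and the arrangements of Figure 44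
for any two distinct roots are lattice isomorphic but not projectively equivalent. -/
theorem figure44_three_components :
    let mk : ℂ → Finset (Submodule ℂ Vc) := fun t =>
      ([lineEq 1 0 0, lineEq 0 1 0, lineEq 0 0 1,
        lineEq 1 0 (-1), lineEq 0 1 (-1),
        lineEq 1 0 (-(t - 1)), lineEq 1 0 (-t), lineEq 1 0 (-((t - 1) / (t - 2))),
        lineEq 1 (1 - t) (-1), lineEq 1 (t - (t - 1) / (t - 2)) (-t),
        lineEq 1 (-(t - 1)) 0, lineEq 1 ((t - 1) / (t - 2)) (-((t - 1) / (t - 2)))] :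
        List (Submodule ℂ Vc)).toFinset
    (∃ a b c : ℂ, a ≠ b ∧ a ≠ c ∧ b ≠ c ∧
      a ^ 3 - 3 * a ^ 2 + 2 * a - 2 = 0 ∧ b ^ 3 - 3 * b ^ 2 + 2 * b - 2 = 0 ∧
      c ^ 3 - 3 * c ^ 2 + 2 * c - 2 = 0) ∧
    ∀ t t' : ℂ, t ^ 3 - 3 * t ^ 2 + 2 * t - 2 = 0 → t' ^ 3 - 3 * t' ^ 2 + 2 * t' - 2 = 0 →
      t ≠ t' → LatticeIso 12 (mk t) (mk t') ∧ ¬ ProjEquiv (mk t) (mk t') := by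
  intro mk
  refine ⟨exists_three_roots, fun t t' ht ht' hne => ?_⟩
  have hroot : ∀ {t : ℂ}, t ^ 3 - 3 * t ^ 2 + 2 * t - 2 = 0 → (t - 1) ^ 3 = (t - 1) + 2 := by
    intro t ht
    linear_combination ht
  have hmk : ∀ {t : ℂ}, t ^ 3 - 3 * t ^ 2 + 2 * t - 2 = 0 →
      ∀ M, M ∈ mk t ↔ ∃ i, arrLine (t - 1) i = M := by
    intro t ht M
    have ht2 : t - 2 ≠ 0 := by
      intro h
      have : t = 2 := by linear_combination h
      norm_num [this] at ht
    have h3 : (t - 1) / (t - 2) = ((t - 1) ^ 2 + (t - 1) + 2) / 2 := by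
      rw [div_eq_div_iff ht2 two_ne_zero]
      linear_combination -ht
    have hlist : mk t = (List.ofFn (arrLine (t - 1))).toFinset := by
      simp only [mk, h3]
      congr 1
      simp only [List.ofFn_succ, List.ofFn_zero, List.cons.injEq, and_true]
      have two_ne : (2 : ℂ) ≠ 0 := two_ne_zero
      refine ⟨?_, ?_, ?_, ?_, ?_, ?_, ?_, (lineEq_smul two_ne _ _ _).symm.trans ?_, ?_,
        (lineEq_smul two_ne _ _ _).symm.trans ?_, ?_,
        (lineEq_smul two_ne _ _ _).symm.trans ?_⟩ <;>
      · simp only [arrLine]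
        congr 1 <;> simp [coeffs, CubicInt.eval] <;> ring
    rw [hlist, List.mem_toFinset, List.mem_ofFn]
  have hs := hroot ht
  have hs' := hroot ht'
  refine ⟨⟨arrLine (t - 1), arrLine (t' - 1), arrLine_injective hs, arrLine_injective hs',
    hmk ht, hmk ht', finrank_iInf_eq_of_concurrent_iff (finrank_arrLine hs) (finrank_arrLine hs')
      (arrLine_injective hs) (arrLine_injective hs') fun i j k => ?_⟩, ?_⟩
  · rw [arrLine_inf_ne_bot_iff hs, arrLine_inf_ne_bot_iff hs']
  rintro ⟨g, hg⟩
  have hex : ∀ i, ∃ j, arrLine (t' - 1) j =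
      (arrLine (t - 1) i).map (g : Vc →ₗ[ℂ] Vc) := by
    intro i
    rw [← hmk ht', ← Finset.mem_coe, ← hg]
    exact ⟨_, Finset.mem_coe.2 ((hmk ht _).2 ⟨i, rfl⟩), rfl⟩
  choose σ hσ using hex
  have hginj : Function.Injective (g : Vc →ₗ[ℂ] Vc) := g.injective
  have hσinj : Function.Injective σ := by
    intro i j hij
    apply arrLine_injective hs
    apply Submodule.map_injective_of_injective hginj
    rw [← hσ, ← hσ, hij]
  obtain ⟨h0, h2, h3, h5⟩ := fixes_of_concurrent_iff
    (Equiv.ofBijective σ (Finite.injective_iff_bijective.1 hσinj)) (by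
      intro i j k
      rw [← arrLine_inf_ne_bot_iff hs', ← arrLine_inf_ne_bot_iff hs]
      simp only [Equiv.ofBijective_apply, hσ, ← Submodule.map_inf _ hginj, ne_eq,
        Submodule.map_eq_bot_iff])
  have e0 := hσ 0
  have e2 := hσ 2
  have e3 := hσ 3
  have e5 := hσ 5
  simp only [Equiv.ofBijective_apply] at h0 h2 h3 h5
  rw [h0] at e0
  rw [h2] at e2
  rw [h3] at e3
  rw [h5] at e5
  simp only [arrLine] at e0 e2 e3 e5
  have := eq_of_map_pencil (s := t - 1) (s' := t' - 1) g
    (by simpa [coeffs, CubicInt.eval] using e0.symm)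
    (by simpa [coeffs, CubicInt.eval] using e2.symm)
    (by simpa [coeffs, CubicInt.eval] using e3.symm)
    (by simpa [coeffs, CubicInt.eval] using e5.symm)
  exact hne (by linear_combination this)
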